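/- Let (h,u) be a C² smooth solution of the radially symmetric isentropic Euler equations in sound-speed form on an open set contained in {r > 0}, with h > 0 and c₁ c₂ ≠ 0 everywhere on that set. Then at every point, ∂₂( h^{−(γ+1)/(2(γ−1))} α̃ ) = [ ((γ+1)/4) h^{−(γ−3)/(2(γ−1))} α̃ + (m c₁/(2 r c₂²)) ((γ−1)/2 · u² − h²) ] · h^{−(γ+1)/(2(γ−1))} (β̃ − α̃) + ( m u² [ c₂² + (γ−3) h² ] / (r c₁ c₂²) ) h^{−(γ+1)/(2(γ−1))} α̃. -/

import Mathlib

open Real Set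

/-- Partial derivative with respect to the spatial variable `r` (first coordinate). -/
noncomputable def pdr (f : ℝ × ℝ → ℝ) (p : ℝ × ℝ) : ℝ := fderiv ℝ f p (1, 0)

/-- Partial derivative with respect to the time variable `t` (second coordinate). -/
noncomputable def pdt (f : ℝ × ℝ → ℝ) (p : ℝ × ℝ) : ℝ := fderiv ℝ f p (0, 1)

/-- Directional derivative `∂_t + c ∂_r` along a characteristic with speed `c`. -/
noncomputable def Dc (c f : ℝ × ℝ → ℝ) (p : ℝ × ℝ) : ℝ := pdt f p + c p * pdr f p

/-- `(h,u)` solves the radially symmetric isentropic Euler equations in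
sound-speed form on the set `U`. -/
def IsEulerSound (γ : ℝ) (m : ℕ) (U : Set (ℝ × ℝ)) (h u : ℝ × ℝ → ℝ) : Prop :=
  ∀ p ∈ U,
    pdt h p + u p * pdr h p + (γ - 1) / 2 * h p * pdr u p
      = -((γ - 1) / 2) * ((m : ℝ) * u p * h p / p.1) ∧
    pdt u p + u p * pdr u p + 2 / (γ - 1) * h p * pdr h p = 0

/-- The gradient variable `α = u_r + (2/(γ-1)) h_r + m h u / (r c₂)`. -/
noncomputable def alp (γ : ℝ) (m : ℕ) (h u : ℝ × ℝ → ℝ) (p : ℝ × ℝ) : ℝ :=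
  pdr u p + 2 / (γ - 1) * pdr h p + (m : ℝ) * h p * u p / (p.1 * (u p + h p))

/-- The gradient variable `β = u_r - (2/(γ-1)) h_r - m h u / (r c₁)`. -/
noncomputable def bet (γ : ℝ) (m : ℕ) (h u : ℝ × ℝ → ℝ) (p : ℝ × ℝ) : ℝ :=
  pdr u p - 2 / (γ - 1) * pdr h p - (m : ℝ) * h p * u p / (p.1 * (u p - h p))

/-- The weighted gradient variable `α̃ = h^{(γ-3)/(2(γ-1))} α`. -/
noncomputable def alpT (γ : ℝ) (m : ℕ) (h u : ℝ × ℝ → ℝ) (p : ℝ × ℝ) : ℝ :=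
  h p ^ ((γ - 3) / (2 * (γ - 1))) * alp γ m h u p

/-- The weighted gradient variable `β̃ = h^{(γ-3)/(2(γ-1))} β`. -/
noncomputable def betT (γ : ℝ) (m : ℕ) (h u : ℝ × ℝ → ℝ) (p : ℝ × ℝ) : ℝ :=
  h p ^ ((γ - 3) / (2 * (γ - 1))) * bet γ m h u p

/-- derivative of a function along a line through `p`. -/
lemma hasDerivAt_line {f : ℝ × ℝ → ℝ} {p : ℝ × ℝ} (hf : DifferentiableAt ℝ f p) (v : ℝ × ℝ) :
    HasDerivAt (fun s : ℝ => f (p + s • v)) (fderiv ℝ f p v) 0 := by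
  have h1 : HasDerivAt (fun s : ℝ => p + s • v) v 0 := by
    simpa using ((hasDerivAt_id (0 : ℝ)).smul_const v).const_add p
  have h2 : HasFDerivAt f (fderiv ℝ f p) (p + (0 : ℝ) • v) := by
    simpa using hf.hasFDerivAt
  exact h2.comp_hasDerivAt (0 : ℝ) h1

lemma fderiv_dir {f : ℝ × ℝ → ℝ} {p : ℝ × ℝ} (c : ℝ) :
    fderiv ℝ f p (c, 1) = pdt f p + c * pdr f p := by
  have : ((c, 1) : ℝ × ℝ) = (0, 1) + c • ((1, 0) : ℝ × ℝ) := by ext <;> simp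
  rw [this, map_add, map_smul, pdt, pdr, smul_eq_mul]

lemma diff_fderiv_apply {f : ℝ × ℝ → ℝ} {p : ℝ × ℝ} (hf : ContDiffAt ℝ 2 f p) (v : ℝ × ℝ) :
    DifferentiableAt ℝ (fun q => fderiv ℝ f q v) p := by
  have h1 : DifferentiableAt ℝ (fderiv ℝ f) p :=
    (hf.fderiv_right (m := 1) (by norm_num)).differentiableAt (by norm_num)
  exact h1.clm_apply (differentiableAt_const v)

lemma mixed {f : ℝ × ℝ → ℝ} {p : ℝ × ℝ} (hf : ContDiffAt ℝ 2 f p) :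
    pdt (pdr f) p = pdr (pdt f) p := by
  have h1 : DifferentiableAt ℝ (fderiv ℝ f) p :=
    (hf.fderiv_right (m := 1) (by norm_num)).differentiableAt (by norm_num)
  have h2 : ∀ v w : ℝ × ℝ,
      fderiv ℝ (fun q => fderiv ℝ f q v) p w = fderiv ℝ (fderiv ℝ f) p w v := by
    intro v w
    have := (h1.hasFDerivAt.clm_apply (hasFDerivAt_const v p)).fderiv
    rw [this]; simp
  have h3 : IsSymmSndFDerivAt ℝ f p := hf.isSymmSndFDerivAt (by simp)
  change fderiv ℝ (fun q => fderiv ℝ f q (1, 0)) p (0, 1)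
    = fderiv ℝ (fun q => fderiv ℝ f q (0, 1)) p (1, 0)
  rw [h2, h2]
  exact h3 _ _

/-- for a `C²` smooth solution with `h > 0` and `c₁c₂ ≠ 0`,
`∂₂(h^{-(γ+1)/(2(γ-1))} α̃)
  = [((γ+1)/4) h^{-(γ-3)/(2(γ-1))} α̃ + (mc₁/(2rc₂²))((γ-1)/2·u² - h²)]
      · h^{-(γ+1)/(2(γ-1))} (β̃ - α̃)
    + (mu²[c₂² + (γ-3)h²]/(rc₁c₂²)) h^{-(γ+1)/(2(γ-1))} α̃`. -/
theorem d2_weighted_alpha_equation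
    (γ : ℝ) (hγ : 1 < γ) (m : ℕ) (hm : 1 ≤ m)
    (U : Set (ℝ × ℝ)) (hU : IsOpen U) (hUr : ∀ p ∈ U, 0 < p.1)
    (h u : ℝ × ℝ → ℝ) (hhpos : ∀ p ∈ U, 0 < h p)
    (hc : ∀ p ∈ U, (u p - h p) * (u p + h p) ≠ 0)
    (hhC : ContDiffOn ℝ 2 h U) (huC : ContDiffOn ℝ 2 u U)
    (heuler : IsEulerSound γ m U h u) :
    ∀ p ∈ U,
      Dc (fun q => u q + h q)
          (fun q => h q ^ (-(γ + 1) / (2 * (γ - 1))) * alpT γ m h u q) p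
        = ((γ + 1) / 4 * h p ^ (-(γ - 3) / (2 * (γ - 1))) * alpT γ m h u p
            + (m : ℝ) * (u p - h p) / (2 * p.1 * (u p + h p) ^ 2)
                * ((γ - 1) / 2 * u p ^ 2 - h p ^ 2))
            * (h p ^ (-(γ + 1) / (2 * (γ - 1))) * (betT γ m h u p - alpT γ m h u p))
          + (m : ℝ) * u p ^ 2 * ((u p + h p) ^ 2 + (γ - 3) * h p ^ 2)
              / (p.1 * (u p - h p) * (u p + h p) ^ 2)
            * (h p ^ (-(γ + 1) / (2 * (γ - 1))) * alpT γ m h u p) := by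
  intro p hp
  have hUn : U ∈ nhds p := hU.mem_nhds hp
  have ch : ContDiffAt ℝ 2 h p := hhC.contDiffAt hUn
  have cu : ContDiffAt ℝ 2 u p := huC.contDiffAt hUn
  have dh : DifferentiableAt ℝ h p := ch.differentiableAt (by norm_num)
  have du : DifferentiableAt ℝ u p := cu.differentiableAt (by norm_num)
  have dhr : DifferentiableAt ℝ (pdr h) p := diff_fderiv_apply ch (1, 0)
  have dur : DifferentiableAt ℝ (pdr u) p := diff_fderiv_apply cu (1, 0)
  have dht : DifferentiableAt ℝ (pdt h) p := diff_fderiv_apply ch (0, 1)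
  have dut : DifferentiableAt ℝ (pdt u) p := diff_fderiv_apply cu (0, 1)
  have hr : p.1 ≠ 0 := (hUr p hp).ne'
  have hh : h p ≠ 0 := (hhpos p hp).ne'
  have hc1 : u p - h p ≠ 0 := left_ne_zero_of_mul (hc p hp)
  have hc2 : u p + h p ≠ 0 := right_ne_zero_of_mul (hc p hp)
  have hg : γ - 1 ≠ 0 := by linarith
  have dfst : DifferentiableAt ℝ (fun q : ℝ × ℝ => q.1) p := differentiableAt_fst
  have ffst : ∀ v : ℝ × ℝ, fderiv ℝ (fun q : ℝ × ℝ => q.1) p v = v.1 := by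
    intro v
    rw [show (fun q : ℝ × ℝ => q.1) = Prod.fst from rfl, fderiv_fst]; rfl
  -- points on the line stay in U
  have hline : ∀ v : ℝ × ℝ, ∀ᶠ s in nhds (0 : ℝ), p + s • v ∈ U := by
    intro v
    have hcont : Continuous (fun s : ℝ => p + s • v) := by fun_prop
    exact hcont.continuousAt.eventually_mem (by simpa using hUn)
  -- r-derivatives of the equations
  have Eu : pdr (pdt u) p = -(pdr u p * pdr u p + u p * pdr (pdr u) p)
      - 2 / (γ - 1) * (pdr h p * pdr h p + h p * pdr (pdr h) p) := by
    have h1 := hasDerivAt_line dut (1, 0)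
    have h2 := (((hasDerivAt_line du (1, 0)).mul (hasDerivAt_line dur (1, 0))).neg).sub
      (((hasDerivAt_line dh (1, 0)).mul (hasDerivAt_line dhr (1, 0))).const_mul (2 / (γ - 1)))
    have h3 := h1.congr_of_eventuallyEq (f₁ := _) ?_ |>.unique h2
    · simpa [pdr] using h3
    · filter_upwards [hline (1, 0)] with s hs
      have := (heuler _ hs).2
      simp only [Pi.mul_apply, Pi.neg_apply, Pi.sub_apply]
      linarith
  have Eh : pdr (pdt h) p = -(pdr u p * pdr h p + u p * pdr (pdr h) p)
      - (γ - 1) / 2 * (pdr h p * pdr u p + h p * pdr (pdr u) p)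
      - (γ - 1) / 2 * (m * (((pdr u p * h p + u p * pdr h p) * p.1 - u p * h p) / p.1 ^ 2)) := by
    have h1 := hasDerivAt_line dht (1, 0)
    have h2 := ((((hasDerivAt_line du (1, 0)).mul (hasDerivAt_line dhr (1, 0))).neg).sub
      (((hasDerivAt_line dh (1, 0)).mul (hasDerivAt_line dur (1, 0))).const_mul ((γ - 1) / 2))).sub
      (((((hasDerivAt_line du (1, 0)).mul (hasDerivAt_line dh (1, 0))).div
        (hasDerivAt_line dfst (1, 0)) (by simpa using hr)).const_mul (m : ℝ)).const_mul ((γ - 1) / 2))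
    have h3 := h1.congr_of_eventuallyEq (f₁ := _) ?_ |>.unique h2
    · rw [ffst] at h3
      simp only [Pi.mul_apply, zero_smul, add_zero] at h3
      simpa [pdr] using h3
    · filter_upwards [hline (1, 0)] with s hs
      have := (heuler _ hs).1
      simp only [Pi.mul_apply, Pi.neg_apply, Pi.sub_apply, Pi.div_apply]
      linear_combination -this
  have Mu := mixed cu
  have Mh := mixed ch
  obtain ⟨e1, e2⟩ := heuler p hp
  set A : ℝ := -(γ + 1) / (2 * (γ - 1)) with hA
  set B : ℝ := (γ - 3) / (2 * (γ - 1)) with hB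
  have hnB : -(γ - 3) / (2 * (γ - 1)) = -B := by rw [hB]; ring
  rw [hnB, rpow_neg (hhpos p hp).le]
  have dalp : DifferentiableAt ℝ (alp γ m h u) p := by
    unfold alp
    have hd : DifferentiableAt ℝ (fun q : ℝ × ℝ => q.1 * (u q + h q)) p := dfst.mul (du.add dh)
    have hn : DifferentiableAt ℝ (fun q : ℝ × ℝ => (m : ℝ) * h q * u q) p :=
      (dh.const_mul _).mul du
    have hne : (fun q : ℝ × ℝ => q.1 * (u q + h q)) p ≠ 0 := mul_ne_zero hr hc2
    have hq : DifferentiableAt ℝ (fun q : ℝ × ℝ => (m : ℝ) * h q * u q / (q.1 * (u q + h q))) p := by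
      simp only [div_eq_mul_inv]
      exact hn.mul (hd.inv hne)
    exact (dur.add (dhr.const_mul _)).add hq
  have dF : DifferentiableAt ℝ (fun q => h q ^ A * alpT γ m h u q) p := by
    unfold alpT
    exact (dh.rpow_const (Or.inl hh)).mul ((dh.rpow_const (Or.inl hh)).mul dalp)
  set c : ℝ := u p + h p with hcdef
  have Dalp : fderiv ℝ (alp γ m h u) p (c, 1) =
      (pdt (pdr u) p + c * pdr (pdr u) p) + 2 / (γ - 1) * (pdt (pdr h) p + c * pdr (pdr h) p)
      + ((m * (pdt h p + c * pdr h p) * u p + m * h p * (pdt u p + c * pdr u p)) * (p.1 * c)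
          - m * h p * u p * (c * c + p.1 * ((pdt u p + c * pdr u p) + (pdt h p + c * pdr h p))))
        / (p.1 * c) ^ 2 := by
    have h1 := hasDerivAt_line dalp (c, 1)
    have h2 := ((hasDerivAt_line dur (c, 1)).add
      ((hasDerivAt_line dhr (c, 1)).const_mul (2 / (γ - 1)))).add
      ((((hasDerivAt_line dh (c, 1)).const_mul (m : ℝ)).mul (hasDerivAt_line du (c, 1))).div
        ((hasDerivAt_line dfst (c, 1)).mul
          ((hasDerivAt_line du (c, 1)).add (hasDerivAt_line dh (c, 1))))
        (by
          simp only [Pi.mul_apply, Pi.add_apply, zero_smul, add_zero]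
          exact mul_ne_zero hr hc2))
    have h3 := h1.unique h2
    rw [h3, ffst]
    simp only [fderiv_dir, zero_smul, add_zero, Pi.mul_apply, Pi.add_apply, ← hcdef]
  have DF : Dc (fun q => u q + h q) (fun q => h q ^ A * alpT γ m h u q) p =
      (A * (h p ^ A / h p) * (pdt h p + c * pdr h p)) * (h p ^ B * alp γ m h u p)
      + h p ^ A * ((B * (h p ^ B / h p) * (pdt h p + c * pdr h p)) * alp γ m h u p
        + h p ^ B * fderiv ℝ (alp γ m h u) p (c, 1)) := by
    have h1 := hasDerivAt_line dF (c, 1)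
    have hl := hasDerivAt_line dh (c, 1)
    have h2 := (hl.rpow_const (p := A) (Or.inl (by simpa using hh))).mul
      ((hl.rpow_const (p := B) (Or.inl (by simpa using hh))).mul (hasDerivAt_line dalp (c, 1)))
    have h3 := h1.unique h2
    have h4 : Dc (fun q => u q + h q) (fun q => h q ^ A * alpT γ m h u q) p
      = fderiv ℝ (fun q => h q ^ A * alpT γ m h u q) p (c, 1) := by
      rw [fderiv_dir]; rfl
    rw [h4, h3]
    simp only [fderiv_dir, zero_smul, add_zero, Pi.mul_apply, rpow_sub_one hh]
    ring
  have et : pdt h p = -(u p * pdr h p) - (γ - 1) / 2 * h p * pdr u p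
      - (γ - 1) / 2 * (m * u p * h p / p.1) := by linear_combination e1
  have eut : pdt u p = -(u p * pdr u p) - 2 / (γ - 1) * h p * pdr h p := by
    linear_combination e2
  have hX : h p ^ A ≠ 0 := (rpow_pos_of_pos (hhpos p hp) A).ne'
  have hY : h p ^ B ≠ 0 := (rpow_pos_of_pos (hhpos p hp) B).ne'
  rw [DF, Dalp, Mu, Mh, Eu, Eh, et, eut]
  unfold alpT betT
  rw [← hB]
  unfold alp bet
  rw [← hcdef]
  clear_value A B
  generalize h p ^ A = X at *
  generalize h p ^ B = Y at *
  generalize pdr (pdr u) p = urr at *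
  generalize pdr (pdr h) p = hrr at *
  generalize pdr u p = a at *
  generalize pdr h p = b at *
  have hAB : A = -(2 / (γ - 1)) - B := by
    rw [hA, hB]; field_simp; ring
  rw [hAB]
  clear * - hr hh hc1 hc2 hg hX hY hcdef
  generalize p.1 = r at *
  generalize u p = v at *
  generalize h p = w at *
  have hv : v = c - w := by linarith
  subst hv
  have hc1' : c - w - w ≠ 0 := hc1
  field_simp
  ring
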